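/- For all x ∈ [0, π_{3/2,2}/4), sin_{3/2,2}(2x) = Φ(Ψ(Φ^{−1}(sin_{3/2,2}(x)))), where Φ(x) = √(1 − ((2 − 2x² + 2√(1−x³)) / (2 + x² + 2√(1−x³)))³), Ψ(x) = 4x √(1−x³) (3 + √(1−x³))³ / ((1 + √(1−x³))(8 + x³)²), and Φ^{−1}(x) = (6x − 2(1 − (1−x²)^{1/3})²) / (2 + (1−x²)^{1/3})². -/

import Mathlib

open MeasureTheory Set
open scoped ENNReal

/-- `genF p q y = ∫_0^y (1 - t^q)^(-1/p) dt`, whose inverse is the generalized sine. -/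
noncomputable def genF (p q y : ℝ) : ℝ := ∫ t in (0:ℝ)..y, (1 - t ^ q) ^ (-(1 / p))

/-- `genG p q y = ∫_0^y (1 + t^q)^(-1/p) dt`, whose inverse is the generalized hyperbolic sine. -/
noncomputable def genG (p q y : ℝ) : ℝ := ∫ t in (0:ℝ)..y, (1 + t ^ q) ^ (-(1 / p))

/-- The generalized π, `π_{p,q} = 2∫_0^1 (1 - t^q)^(-1/p) dt`, as an extended real number
(it is `∞` when `q/(q+1) < p ≤ 1`). -/
noncomputable def genPi (p q : ℝ) : ℝ≥0∞ :=
  2 * ∫⁻ t in Ioo (0:ℝ) 1, ENNReal.ofReal ((1 - t ^ q) ^ (-(1 / p)))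

/-- The generalized sine `sin_{p,q}`: the inverse of `genF p q`, which maps `[0,1)` onto
`[0, π_{p,q}/2)`. -/
noncomputable def gsin (p q : ℝ) : ℝ → ℝ := Function.invFunOn (genF p q) (Ico 0 1)

/-- The generalized cosine `cos_{p,q} x = (d/dx) sin_{p,q} x` (one-sided at `x = 0`). -/
noncomputable def gcos (p q x : ℝ) : ℝ := derivWithin (gsin p q) (Ici 0) x

/-- The generalized hyperbolic sine `sinh_{p,q}`: the inverse of `genG p q`, which maps
`[0,∞)` onto `[0, π_{r,q}/2)` where `r = pq/(pq+p-q)`. -/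
noncomputable def gsinh (p q : ℝ) : ℝ → ℝ := Function.invFunOn (genG p q) (Ici 0)

/-- The generalized hyperbolic cosine `cosh_{p,q} x = (d/dx) sinh_{p,q} x`
(one-sided at `x = 0`). -/
noncomputable def gcosh (p q x : ℝ) : ℝ := derivWithin (gsinh p q) (Ici 0) x

/-- The generalized π, `π_{p,q} = 2∫_0^1 (1 - t^q)^(-1/p) dt`, as a real number
(valid for `p > 1`, where the integral converges). -/
noncomputable def genPiR (p q : ℝ) : ℝ := 2 * ∫ t in (0:ℝ)..1, (1 - t ^ q) ^ (-(1 / p))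

noncomputable def Phi (x : ℝ) : ℝ :=
  Real.sqrt (1 -
    ((2 - 2 * x ^ 2 + 2 * Real.sqrt (1 - x ^ 3)) /
        (2 + x ^ 2 + 2 * Real.sqrt (1 - x ^ 3))) ^ 3)

noncomputable def Psi (x : ℝ) : ℝ :=
  4 * x * Real.sqrt (1 - x ^ 3) * (3 + Real.sqrt (1 - x ^ 3)) ^ 3 /
    ((1 + Real.sqrt (1 - x ^ 3)) * (8 + x ^ 3) ^ 2)

noncomputable def PhiInv (x : ℝ) : ℝ :=
  (6 * x - 2 * (1 - (1 - x ^ 2) ^ ((1:ℝ) / 3)) ^ 2) /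
    (2 + (1 - x ^ 2) ^ ((1:ℝ) / 3)) ^ 2

/-- The generalized cosine of `sin_{3/2,2}`: the function `(1 - s²)^{1/3}` of the sine `s`. -/
noncomputable def cosOfSin (s : ℝ) : ℝ := (1 - s ^ 2) ^ ((1:ℝ) / 3)

/-- The value at `2x` of the function `c = (1 - sin²)^{1/3}`, in terms of its value at `x`. -/
noncomputable def doubleCos (c : ℝ) : ℝ :=
  (c ^ 4 + 8 * c ^ 3 + 8 * c - 8) / (2 + 2 * c - c ^ 2) ^ 2

/-- The value of the sine at `2x`, in terms of the values of `sin` and `(1 - sin²)^{1/3}`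
at `x`. -/
noncomputable def doubleSin (s c : ℝ) : ℝ :=
  6 * s * (c ^ 4 + 2 * c ^ 3 + 6 * c ^ 2 - 4 * c + 4) / (2 + 2 * c - c ^ 2) ^ 3

lemma cosOfSin_nonneg {s : ℝ} (hs : s ^ 2 ≤ 1) : 0 ≤ cosOfSin s :=
  Real.rpow_nonneg (by linarith) _

lemma cosOfSin_pos {s : ℝ} (hs : s ^ 2 < 1) : 0 < cosOfSin s :=
  Real.rpow_pos_of_pos (by linarith) _

lemma cosOfSin_cube {s : ℝ} (hs : s ^ 2 ≤ 1) : cosOfSin s ^ 3 = 1 - s ^ 2 := by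
  have h := Real.rpow_inv_natCast_pow (n := 3) (x := 1 - s ^ 2) (by linarith) (by norm_num)
  rw [cosOfSin, one_div]
  exact_mod_cast h

lemma cosOfSin_le_one {s : ℝ} (hs : s ^ 2 ≤ 1) : cosOfSin s ≤ 1 :=
  Real.rpow_le_one (by linarith) (by nlinarith) (by norm_num)

lemma cosOfSin_zero : cosOfSin 0 = 1 := by simp [cosOfSin]

lemma cosOfSin_eq {s c : ℝ} (hc : 0 ≤ c) (h : c ^ 3 = 1 - s ^ 2) : cosOfSin s = c := by
  have h3 := Real.pow_rpow_inv_natCast (n := 3) hc (by norm_num)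
  rw [cosOfSin, ← h, one_div]
  exact_mod_cast h3

lemma continuous_cosOfSin : Continuous cosOfSin := by
  unfold cosOfSin
  exact Continuous.rpow_const (by fun_prop) fun _ => Or.inr (by norm_num)

lemma cosOfSin_lt_cosOfSin {s t : ℝ} (hs : 0 ≤ s) (hst : s < t) (ht : t ≤ 1) :
    cosOfSin t < cosOfSin s :=
  Real.rpow_lt_rpow (by nlinarith) (by nlinarith) (by norm_num)

lemma cosOfSin_rpow_neg {s : ℝ} (hs : s ^ 2 ≤ 1) :
    (1 - s ^ (2:ℝ)) ^ (-(1 / (3 / 2 : ℝ))) = (cosOfSin s ^ 2)⁻¹ := by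
  rw [Real.rpow_neg (by rw [Real.rpow_two]; linarith), Real.rpow_two, cosOfSin,
    ← Real.rpow_mul_natCast (by linarith)]
  norm_num

lemma hasDerivAt_cosOfSin {s : ℝ} (hs : s ^ 2 < 1) :
    HasDerivAt cosOfSin (-(2 * s) / (3 * cosOfSin s ^ 2)) s := by
  have h1 : HasDerivAt (fun t : ℝ => 1 - t ^ 2) (-(2 * s)) s := by
    simpa using (hasDerivAt_pow 2 s).const_sub 1
  have h2 := h1.rpow_const (p := (1:ℝ) / 3) (Or.inl (by linarith))
  have h3 : (1 - s ^ 2) ^ ((1:ℝ) / 3 - 1) = (cosOfSin s ^ 2)⁻¹ := by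
    rw [← cosOfSin_rpow_neg hs.le, Real.rpow_two]
    norm_num
  rw [h3] at h2
  have := cosOfSin_pos hs
  refine h2.congr_deriv ?_
  field_simp

lemma two_add_two_mul_sub_sq_pos {c : ℝ} (h0 : 0 ≤ c) (h1 : c ≤ 1) :
    0 < 2 + 2 * c - c ^ 2 := by
  nlinarith

lemma doubleSin_sq {s c : ℝ} (h0 : 0 ≤ c) (h1 : c ≤ 1) (h : c ^ 3 = 1 - s ^ 2) :
    doubleCos c ^ 3 = 1 - doubleSin s c ^ 2 := by
  have hq := two_add_two_mul_sub_sq_pos h0 h1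
  have hs : s ^ 2 = 1 - c ^ 3 := by linarith
  rw [doubleSin, doubleCos, div_pow _ _ 2, mul_pow, mul_pow, hs]
  obtain ⟨q, hq_eq⟩ : ∃ q, 2 + 2 * c - c ^ 2 = q := ⟨_, rfl⟩
  rw [hq_eq] at hq ⊢
  field_simp
  subst hq_eq
  ring

lemma doubleSin_nonneg {s c : ℝ} (hs : 0 ≤ s) (h0 : 0 ≤ c) (h1 : c ≤ 1) :
    0 ≤ doubleSin s c := by
  have hq := two_add_two_mul_sub_sq_pos h0 h1
  have : 0 ≤ c ^ 4 + 2 * c ^ 3 + 6 * c ^ 2 - 4 * c + 4 := by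
    have : 0 ≤ c ^ 4 + 2 * c ^ 3 := by positivity
    nlinarith
  unfold doubleSin
  positivity

lemma doubleSin_sq_le_one {s c : ℝ} (h0 : 0 ≤ c) (h1 : c ≤ 1) (h : c ^ 3 = 1 - s ^ 2)
    (hN : 0 ≤ doubleCos c) : doubleSin s c ^ 2 ≤ 1 := by
  have := pow_nonneg hN 3
  linarith [doubleSin_sq h0 h1 h]

lemma doubleSin_sq_lt_one {s c : ℝ} (h0 : 0 ≤ c) (h1 : c ≤ 1) (h : c ^ 3 = 1 - s ^ 2)
    (hN : 0 < doubleCos c) : doubleSin s c ^ 2 < 1 := by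
  have := pow_pos hN 3
  linarith [doubleSin_sq h0 h1 h]

lemma cosOfSin_doubleSin {s c : ℝ} (h0 : 0 ≤ c) (h1 : c ≤ 1) (h : c ^ 3 = 1 - s ^ 2)
    (hN : 0 ≤ doubleCos c) : cosOfSin (doubleSin s c) = doubleCos c :=
  cosOfSin_eq hN (doubleSin_sq h0 h1 h)

lemma doubleCos_pos_of_lt {a c : ℝ} (ha : 0 ≤ a) (hac : a < c) (hc : c ≤ 1)
    (hN : 0 ≤ doubleCos a) : 0 < doubleCos c := by
  have hqa := two_add_two_mul_sub_sq_pos ha (hac.le.trans hc)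
  have hqc := two_add_two_mul_sub_sq_pos (ha.trans hac.le) hc
  have hNa : 0 ≤ a ^ 4 + 8 * a ^ 3 + 8 * a - 8 := by
    by_contra! hlt
    exact absurd hN (not_le.2 (div_neg_of_neg_of_pos hlt (by positivity)))
  have h4 : a ^ 4 ≤ c ^ 4 := by gcongr
  have h3 : a ^ 3 ≤ c ^ 3 := by gcongr
  exact div_pos (by linarith) (by positivity)

lemma one_sub_PhiInv_cube {s : ℝ} (hs1 : s ^ 2 ≤ 1) :
    1 - PhiInv s ^ 3 =
      ((12 + 18 * cosOfSin s ^ 2 - 3 * cosOfSin s ^ 3 - 12 * s * (1 - cosOfSin s)) /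
        (2 + cosOfSin s) ^ 3) ^ 2 := by
  have hc0 := cosOfSin_nonneg hs1
  have hc := cosOfSin_cube hs1
  have hu : PhiInv s = (6 * s - 2 * (1 - cosOfSin s) ^ 2) / (2 + cosOfSin s) ^ 2 := rfl
  rw [hu]
  generalize cosOfSin s = c at *
  field_simp
  linear_combination (72 - 216 * s - 144 * c + 72 * c ^ 2) * hc

lemma sqrt_one_sub_PhiInv_cube {s : ℝ} (hs : 0 ≤ s) (hs1 : s ^ 2 ≤ 1) :
    √(1 - PhiInv s ^ 3) =
      (12 + 18 * cosOfSin s ^ 2 - 3 * cosOfSin s ^ 3 - 12 * s * (1 - cosOfSin s)) /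
        (2 + cosOfSin s) ^ 3 := by
  have hc0 := cosOfSin_nonneg hs1
  have hc1 := cosOfSin_le_one hs1
  rw [one_sub_PhiInv_cube hs1]
  generalize cosOfSin s = c at *
  have hsle : s ≤ 1 := by nlinarith
  have hw : 0 ≤ 12 + 18 * c ^ 2 - 3 * c ^ 3 - 12 * s * (1 - c) := by
    have h1 : s * (1 - c) ≤ 1 := by nlinarith
    have h2 : c ^ 3 ≤ c ^ 2 := pow_le_pow_of_le_one hc0 hc1 (by norm_num)
    nlinarith [sq_nonneg c]
  exact Real.sqrt_sq (by positivity)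

lemma Phi_PhiInv {s : ℝ} (hs : 0 ≤ s) (hs1 : s ^ 2 ≤ 1) : Phi (PhiInv s) = s := by
  have hw := sqrt_one_sub_PhiInv_cube hs hs1
  have hw0 := Real.sqrt_nonneg (1 - PhiInv s ^ 3)
  have hc0 := cosOfSin_nonneg hs1
  have hc := cosOfSin_cube hs1
  have hu : PhiInv s = (6 * s - 2 * (1 - cosOfSin s) ^ 2) / (2 + cosOfSin s) ^ 2 := rfl
  have key : (2 - 2 * PhiInv s ^ 2 + 2 * √(1 - PhiInv s ^ 3)) /
      (2 + PhiInv s ^ 2 + 2 * √(1 - PhiInv s ^ 3)) = cosOfSin s := by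
    rw [div_eq_iff (by positivity), hw, hu]
    field_simp
    linear_combination -(72 + 36 * cosOfSin s) * hc
  rw [Phi, key, hc, sub_sub_cancel, Real.sqrt_sq hs]

lemma Psi_PhiInv {s : ℝ} (hs : 0 ≤ s) (hs1 : s ^ 2 < 1) (hN : 0 ≤ doubleCos (cosOfSin s)) :
    Psi (PhiInv s) = PhiInv (doubleSin s (cosOfSin s)) := by
  have hw := sqrt_one_sub_PhiInv_cube hs hs1.le
  have hw0 := Real.sqrt_nonneg (1 - PhiInv s ^ 3)
  have hc0 := cosOfSin_pos hs1
  have hc1 := cosOfSin_le_one hs1.le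
  have hc := cosOfSin_cube hs1.le
  have hu : PhiInv s = (6 * s - 2 * (1 - cosOfSin s) ^ 2) / (2 + cosOfSin s) ^ 2 := rfl
  have hU : PhiInv (doubleSin s (cosOfSin s)) =
      4 * s * ((cosOfSin s ^ 4 + 2 * cosOfSin s ^ 3 + 6 * cosOfSin s ^ 2 - 4 * cosOfSin s + 4) *
        (2 + 2 * cosOfSin s - cosOfSin s ^ 2) - 8 * s ^ 3) /
          (cosOfSin s ^ 2 * (cosOfSin s ^ 3 + 8) ^ 2) := by
    have hV : PhiInv (doubleSin s (cosOfSin s)) = (6 * doubleSin s (cosOfSin s) -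
      2 * (1 - cosOfSin (doubleSin s (cosOfSin s))) ^ 2) /
        (2 + cosOfSin (doubleSin s (cosOfSin s))) ^ 2 := rfl
    rw [hV, cosOfSin_doubleSin hc0.le hc1 hc hN]
    have hq := two_add_two_mul_sub_sq_pos hc0.le hc1
    generalize cosOfSin s = c at *
    rw [doubleSin, doubleCos]
    have h1 : 1 - (c ^ 4 + 8 * c ^ 3 + 8 * c - 8) / (2 + 2 * c - c ^ 2) ^ 2 =
        12 * s ^ 2 / (2 + 2 * c - c ^ 2) ^ 2 := by
      rw [eq_div_iff (by positivity), sub_mul, div_mul_cancel₀ _ (by positivity)]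
      linear_combination (-12) * hc
    have h2 : 2 + (c ^ 4 + 8 * c ^ 3 + 8 * c - 8) / (2 + 2 * c - c ^ 2) ^ 2 =
        3 * c * (c ^ 3 + 8) / (2 + 2 * c - c ^ 2) ^ 2 := by
      rw [eq_div_iff (by positivity), add_mul, div_mul_cancel₀ _ (by positivity)]
      ring
    rw [h1, h2]
    obtain ⟨q, hq_eq⟩ : ∃ q, 2 + 2 * c - c ^ 2 = q := ⟨_, rfl⟩
    rw [hq_eq] at hq ⊢
    field_simp
    ring
  have hcube : 8 + PhiInv s ^ 3 = (3 - √(1 - PhiInv s ^ 3)) * (3 + √(1 - PhiInv s ^ 3)) := by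
    have h := one_sub_PhiInv_cube hs1.le
    rw [← hw] at h
    linear_combination -h
  have h3w : 0 < 3 - √(1 - PhiInv s ^ 3) := by
    rw [hw, sub_pos, div_lt_iff₀ (by positivity)]
    nlinarith [mul_nonneg hs (sub_nonneg.2 hc1), pow_pos hc0 3, pow_pos hc0 2]
  have hPsi : Psi (PhiInv s) = 4 * PhiInv s * √(1 - PhiInv s ^ 3) *
      (3 + √(1 - PhiInv s ^ 3)) /
        ((1 + √(1 - PhiInv s ^ 3)) * (3 - √(1 - PhiInv s ^ 3)) ^ 2) := by
    rw [Psi, hcube]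
    generalize √(1 - PhiInv s ^ 3) = w at *
    field_simp
  rw [hPsi, hU, div_eq_div_iff (by positivity) (by positivity), hw, hu]
  generalize cosOfSin s = c at *
  field_simp
  linear_combination
    ((110592 * c ^ 2 - 55296 * c ^ 3 + 110592 * c ^ 4 - 82944 * c ^ 5 - 82944 * c ^ 6
    + 41472 * c ^ 7 - 25920 * c ^ 8 - 18144 * c ^ 9 + 5184 * c ^ 10 - 1728 * c ^ 11
    - 1080 * c ^ 12 + 216 * c ^ 13) + (23040 + 152064 * c - 161280 * c ^ 2 + 152064 * c ^ 3
    - 255744 * c ^ 4 - 82944 * c ^ 5 + 77760 * c ^ 6 + 101952 * c ^ 7 - 34560 * c ^ 8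
    + 27072 * c ^ 9 + 1728 * c ^ 10 - 1152 * c ^ 11) * s + (32256 + 50688 * c + 520704 * c ^ 2
    + 195840 * c ^ 3 + 334080 * c ^ 4 - 25344 * c ^ 5 + 190656 * c ^ 6 - 58176 * c ^ 7
    + 17856 * c ^ 8 + 1152 * c ^ 9) * s ^ 2 + (18432 + 92160 * c - 110592 * c ^ 2
    + 184320 * c ^ 3 - 253440 * c ^ 4 + 110592 * c ^ 5 - 47232 * c ^ 6 + 5760 * c ^ 7) * s ^ 3
    + (-4608 - 59904 * c + 161280 * c ^ 2 - 140544 * c ^ 3 + 59904 * c ^ 4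
    - 16128 * c ^ 5) * s ^ 4 + (-13824 + 41472 * c - 41472 * c ^ 2 + 13824 * c ^ 3) * s ^ 5) * hc

lemma hasDerivAt_doubleSin {s : ℝ} (hs : s ^ 2 < 1) :
    HasDerivAt (fun t => doubleSin t (cosOfSin t))
      (2 * doubleCos (cosOfSin s) ^ 2 / cosOfSin s ^ 2) s := by
  have hc0 := cosOfSin_pos hs
  have hc1 := cosOfSin_le_one hs.le
  have hc := cosOfSin_cube hs.le
  have hq := two_add_two_mul_sub_sq_pos hc0.le hc1
  have hd := hasDerivAt_cosOfSin hs
  have hP := ((((hd.pow 4).add ((hd.pow 3).const_mul 2)).add ((hd.pow 2).const_mul 6)).sub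
    (hd.const_mul 4)).add_const 4
  have hQ := (((hd.const_mul 2).const_add 2).sub (hd.pow 2)).pow 3
  have h := (((hasDerivAt_id s).const_mul 6).mul hP).div hQ (by simpa using (pow_pos hq 3).ne')
  refine h.congr_deriv ?_
  simp only [Pi.add_apply, Pi.sub_apply, Pi.mul_apply, Pi.pow_apply, id]
  generalize cosOfSin s = c at *
  obtain ⟨q, hq_eq⟩ : ∃ q, 2 + 2 * c - c ^ 2 = q := ⟨_, rfl⟩
  rw [doubleCos, hq_eq]
  rw [hq_eq] at hq
  field_simp
  subst hq_eq
  linear_combination (1536 - 5184 * c ^ 2 - 1152 * c ^ 3 - 2592 * c ^ 5 + 1584 * c ^ 6 -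
    24 * c ^ 9) * hc

lemma continuousAt_genF_integrand {s : ℝ} (hs : s ^ 2 < 1) :
    ContinuousAt (fun t : ℝ => (1 - t ^ (2:ℝ)) ^ (-(1 / (3 / 2 : ℝ)))) s := by
  simp only [Real.rpow_two]
  exact ContinuousAt.rpow_const (by fun_prop) (Or.inl (by linarith))

lemma hasDerivAt_genF {s : ℝ} (h0 : 0 ≤ s) (h1 : s < 1) :
    HasDerivAt (genF (3 / 2) 2) (cosOfSin s ^ 2)⁻¹ s := by
  rw [← cosOfSin_rpow_neg (by nlinarith : s ^ 2 ≤ 1)]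
  refine intervalIntegral.integral_hasDerivAt_right ?_ ?_
    (continuousAt_genF_integrand (by nlinarith))
  · refine ContinuousOn.intervalIntegrable fun t ht => ?_
    rw [uIcc_of_le h0] at ht
    exact (continuousAt_genF_integrand (by nlinarith [ht.1, ht.2])).continuousWithinAt
  · refine ContinuousOn.stronglyMeasurableAtFilter (isOpen_Ioo (a := -1) (b := 1))
      (fun t ht => ?_) s ⟨by linarith, h1⟩
    exact (continuousAt_genF_integrand (by nlinarith [ht.1, ht.2])).continuousWithinAt

lemma genF_zero (p q : ℝ) : genF p q 0 = 0 := intervalIntegral.integral_same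

lemma continuousOn_genF
    (hI : IntervalIntegrable (fun t : ℝ => (1 - t ^ (2:ℝ)) ^ (-(1 / (3 / 2 : ℝ)))) volume 0 1) :
    ContinuousOn (genF (3 / 2) 2) (Icc 0 1) := by
  have := intervalIntegral.continuousOn_primitive_interval' hI left_mem_uIcc
  rwa [uIcc_of_le zero_le_one] at this

lemma strictMonoOn_genF
    (hI : IntervalIntegrable (fun t : ℝ => (1 - t ^ (2:ℝ)) ^ (-(1 / (3 / 2 : ℝ)))) volume 0 1) :
    StrictMonoOn (genF (3 / 2) 2) (Icc 0 1) := by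
  refine strictMonoOn_of_deriv_pos (convex_Icc 0 1) (continuousOn_genF hI) fun s hs => ?_
  rw [interior_Icc] at hs
  rw [(hasDerivAt_genF hs.1.le hs.2).deriv]
  have := cosOfSin_pos (s := s) (by nlinarith [hs.1, hs.2])
  positivity

lemma genF_doubleSin
    (hI : IntervalIntegrable (fun t : ℝ => (1 - t ^ (2:ℝ)) ^ (-(1 / (3 / 2 : ℝ)))) volume 0 1)
    {s : ℝ} (h0 : 0 ≤ s) (h1 : s < 1) (hN : 0 ≤ doubleCos (cosOfSin s)) :
    genF (3 / 2) 2 (doubleSin s (cosOfSin s)) = 2 * genF (3 / 2) 2 s := by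
  have hsq : ∀ t ∈ Icc 0 s, t ^ 2 < 1 := fun t ht => by nlinarith [ht.1, ht.2]
  have hpos : ∀ t ∈ Ico 0 s, 0 < doubleCos (cosOfSin t) := fun t ht =>
    doubleCos_pos_of_lt (cosOfSin_nonneg (by nlinarith)) (cosOfSin_lt_cosOfSin ht.1 ht.2 h1.le)
      (cosOfSin_le_one (hsq t ⟨ht.1, ht.2.le⟩).le) hN
  have hnonneg : ∀ t ∈ Icc 0 s, 0 ≤ doubleCos (cosOfSin t) := fun t ht => by
    rcases ht.2.eq_or_lt with rfl | hlt
    · exact hN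
    · exact (hpos t ⟨ht.1, hlt⟩).le
  have hcont : ContinuousOn (fun t => genF (3 / 2) 2 (doubleSin t (cosOfSin t)) -
      2 * genF (3 / 2) 2 t) (Icc 0 s) := by
    refine ContinuousOn.sub ?_ (continuousOn_const.mul
      ((continuousOn_genF hI).mono (Icc_subset_Icc_right h1.le)))
    refine (continuousOn_genF hI).comp (f := fun t => doubleSin t (cosOfSin t))
      (fun t ht => (hasDerivAt_doubleSin (hsq t ht)).continuousAt.continuousWithinAt)
      fun t ht => ?_
    have hc0 := cosOfSin_nonneg (hsq t ht).le
    have hc1 := cosOfSin_le_one (hsq t ht).le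
    have hle := doubleSin_sq_le_one hc0 hc1 (cosOfSin_cube (hsq t ht).le) (hnonneg t ht)
    exact ⟨doubleSin_nonneg ht.1 hc0 hc1, (abs_le.1 ((sq_le_one_iff_abs_le_one _).1 hle)).2⟩
  have hder : ∀ t ∈ Ico 0 s, HasDerivWithinAt (fun t => genF (3 / 2) 2
      (doubleSin t (cosOfSin t)) - 2 * genF (3 / 2) 2 t) 0 (Ici t) t := fun t ht => by
    have ht' := hsq t ⟨ht.1, ht.2.le⟩
    have hc0 := cosOfSin_pos ht'
    have hc1 := cosOfSin_le_one ht'.le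
    have hc := cosOfSin_cube ht'.le
    have hR := hpos t ht
    have hlt := doubleSin_sq_lt_one hc0.le hc1 hc hR
    have hF := hasDerivAt_genF (doubleSin_nonneg ht.1 hc0.le hc1)
      (abs_lt.1 ((sq_lt_one_iff_abs_lt_one _).1 hlt)).2
    rw [cosOfSin_doubleSin hc0.le hc1 hc hR.le] at hF
    refine (((HasDerivAt.comp t hF (hasDerivAt_doubleSin ht')).sub
      ((hasDerivAt_genF ht.1 (ht.2.trans h1)).const_mul 2)).congr_deriv ?_).hasDerivWithinAt
    field_simp
    ring
  have h := constant_of_has_deriv_right_zero hcont hder s ⟨h0, le_rfl⟩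
  have hz : doubleSin 0 (cosOfSin 0) = 0 := by simp [doubleSin]
  simp only [hz, genF_zero] at h
  linarith

/-- double-angle formula for `sin_{3/2,2}` on `[0, π_{3/2,2}/4)`:
`sin_{3/2,2}(2x) = Φ(Ψ(Φ⁻¹(sin_{3/2,2} x)))`. -/
theorem double_angle_sin_threehalf_two (x : ℝ) (hx0 : 0 ≤ x)
    (hx : x < genPiR (3/2) 2 / 4) :
    gsin (3/2) 2 (2 * x) = Phi (Psi (PhiInv (gsin (3/2) 2 x))) := by
  have hpi : genPiR (3 / 2) 2 = 2 * genF (3 / 2) 2 1 := rfl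
  have hI : IntervalIntegrable (fun t : ℝ => (1 - t ^ (2:ℝ)) ^ (-(1 / (3 / 2 : ℝ))))
      volume 0 1 := by
    by_contra hI
    have : genF (3 / 2) 2 1 = 0 := intervalIntegral.integral_undef hI
    linarith
  have hmono := strictMonoOn_genF hI
  obtain ⟨s₀, hs₀, hs₀x⟩ : ∃ s ∈ Ico (0:ℝ) 1, genF (3 / 2) 2 s = x :=
    intermediate_value_Ico zero_le_one (continuousOn_genF hI)
      ⟨by rwa [genF_zero], by linarith⟩
  have hmem : gsin (3 / 2) 2 x ∈ Ico (0:ℝ) 1 := Function.invFunOn_mem ⟨s₀, hs₀, hs₀x⟩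
  have heq : genF (3 / 2) 2 (gsin (3 / 2) 2 x) = x := Function.invFunOn_eq ⟨s₀, hs₀, hs₀x⟩
  generalize gsin (3 / 2) 2 x = s at hmem heq
  obtain ⟨h0, h1⟩ := hmem
  have hsq : s ^ 2 < 1 := by nlinarith
  have hR : 0 < doubleCos (cosOfSin s) := by
    by_contra! hle
    have hcont : ContinuousOn (fun t => doubleCos (cosOfSin t)) (Icc 0 s) := by
      intro t ht
      have ht' : t ^ 2 ≤ 1 := by nlinarith [ht.1, ht.2]
      have hq := two_add_two_mul_sub_sq_pos (cosOfSin_nonneg ht') (cosOfSin_le_one ht')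
      have hc := continuous_cosOfSin.continuousAt (x := t)
      unfold doubleCos
      exact (ContinuousAt.div (by fun_prop) (by fun_prop) (by positivity)).continuousWithinAt
    obtain ⟨r, hr, hr0⟩ : ∃ r ∈ Icc 0 s, doubleCos (cosOfSin r) = 0 :=
      intermediate_value_Icc' h0 hcont ⟨hle, by norm_num [cosOfSin_zero, doubleCos]⟩
    have hr1 : r < 1 := hr.2.trans_lt h1
    have hrsq : r ^ 2 ≤ 1 := by nlinarith [hr.1]
    have hc0 := cosOfSin_nonneg hrsq
    have hc1 := cosOfSin_le_one hrsq
    have hT := doubleSin_sq hc0 hc1 (cosOfSin_cube hrsq)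
    have hT1 : doubleSin r (cosOfSin r) = 1 := by
      have := doubleSin_nonneg hr.1 hc0 hc1
      rw [hr0] at hT
      nlinarith
    have hF := genF_doubleSin hI hr.1 hr1 hr0.ge
    rw [hT1] at hF
    have := hmono.monotoneOn ⟨hr.1, hr1.le⟩ ⟨h0, h1.le⟩ hr.2
    linarith
  have hc0 := cosOfSin_nonneg hsq.le
  have hc1 := cosOfSin_le_one hsq.le
  have hc := cosOfSin_cube hsq.le
  have hT0 := doubleSin_nonneg h0 hc0 hc1
  have hTsq := doubleSin_sq_lt_one hc0 hc1 hc hR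
  rw [Psi_PhiInv h0 hsq hR.le, Phi_PhiInv hT0 hTsq.le]
  have hF := genF_doubleSin hI h0 h1 hR.le
  rw [heq] at hF
  have hinj : InjOn (genF (3 / 2) 2) (Ico 0 1) := hmono.injOn.mono Ico_subset_Icc_self
  have hTmem : doubleSin s (cosOfSin s) ∈ Ico (0:ℝ) 1 :=
    ⟨hT0, (abs_lt.1 ((sq_lt_one_iff_abs_lt_one _).1 hTsq)).2⟩
  rw [← hF]
  exact hinj.leftInvOn_invFunOn hTmem
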